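/- For every Q₁=(q₁,q₂), Q₃=(q₅,q₆) ∈ {0,1}², every middle string A = (0, A₁) with A₁ ∈ {0,1}, every x⃗=(x₁,x₂,x₃) ∈ {0,1}³ of even Hamming weight, every sign s ∈ {+1,−1}, and all bits i,j,k,l ∈ {0,1} with i+j even and k+l even, the 6-qubit vector v_{A,x⃗,s} satisfies (I ⊗ I ⊗ P_i ⊗ P_j ⊗ P_k ⊗ P_l) v_{A,x⃗,s} = s · (−1)^{x₁} · (√−1)^{i+j+k+l} · (−1)^{k q₅ + l q₆ + i A₁} · v_{A,x⃗,s}. (The sign (−1)^{x₁} reproduces exactly the four cases x⃗ = (0,0,0), (1,0,1), (0,1,1), (1,1,0) listed in the paper, with signs +, −, +, − respectively.) -/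

import Mathlib

open Matrix Complex

noncomputable section

/-- Single-qubit Pauli X. -/
def Xg : Matrix (Fin 2) (Fin 2) ℂ := !![0, 1; 1, 0]
/-- Single-qubit Pauli Y. -/
def Yg : Matrix (Fin 2) (Fin 2) ℂ := !![0, -Complex.I; Complex.I, 0]
/-- Single-qubit Pauli Z. -/
def Zg : Matrix (Fin 2) (Fin 2) ℂ := !![1, 0; 0, -1]
/-- P₀ = X, P₁ = Y. -/
def Pg : Fin 2 → Matrix (Fin 2) (Fin 2) ℂ := fun i => if i = 0 then Xg else Yg

/-- Tensor (Kronecker) product of `n` single-qubit operators, as a matrix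
indexed by bit strings. -/
def tens {n : ℕ} (M : Fin n → Matrix (Fin 2) (Fin 2) ℂ) :
    Matrix (Fin n → Fin 2) (Fin n → Fin 2) ℂ :=
  Matrix.of fun r c => ∏ m, M m (r m) (c m)

/-- Computational basis vector |q⟩. -/
def ket {n : ℕ} (q : Fin n → Fin 2) : (Fin n → Fin 2) → ℂ :=
  fun r => if r = q then 1 else 0

/-- The eigenvector v_{A,x⃗,s} of the paper (6 qubits), with A = (0, A₁). -/
def vA (q₁ q₂ q₅ q₆ A₁ x₁ x₂ x₃ : Fin 2) (s : ℂ) : (Fin 6 → Fin 2) → ℂ :=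
  (ket ![q₁, q₂, 0, A₁, q₅, q₆]
    + ((-1 : ℂ) ^ (x₁ : ℕ)) • ket ![q₁, q₂, 0, A₁, q₅+1, q₆+1]
    + ((-1 : ℂ) ^ (x₂ : ℕ)) • ket ![q₁+1, q₂+1, 0, A₁, q₅, q₆]
    + ((-1 : ℂ) ^ (x₃ : ℕ)) • ket ![q₁+1, q₂+1, 0, A₁, q₅+1, q₆+1])
  + s • (ket ![q₁, q₂, 1, A₁+1, q₅, q₆]
    + ((-1 : ℂ) ^ (x₁ : ℕ)) • ket ![q₁, q₂, 1, A₁+1, q₅+1, q₆+1]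
    + ((-1 : ℂ) ^ (x₂ : ℕ)) • ket ![q₁+1, q₂+1, 1, A₁+1, q₅, q₆]
    + ((-1 : ℂ) ^ (x₃ : ℕ)) • ket ![q₁+1, q₂+1, 1, A₁+1, q₅+1, q₆+1])

/-- A tensor product of operators whose `m`-th factor sends the `q m`-th basis vector to `c m` times
the `p m`-th one sends `|q⟩` to `∏ m, c m` times `|p⟩`. -/
theorem tens_mulVec_ket {n : ℕ} (M : Fin n → Matrix (Fin 2) (Fin 2) ℂ) (q p : Fin n → Fin 2)
    (c : Fin n → ℂ) (h : ∀ m r, M m r (q m) = if r = p m then c m else 0) :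
    (tens M).mulVec (ket q) = (∏ m, c m) • ket p := by
  funext r
  simp only [Matrix.mulVec, dotProduct, tens, ket, Matrix.of_apply, mul_ite, mul_one, mul_zero,
    Finset.sum_ite_eq', Finset.mem_univ, if_true, Pi.smul_apply, smul_eq_mul, h]
  split_ifs with hr
  · simp [hr]
  · obtain ⟨m, hm⟩ := Function.ne_iff.mp hr
    exact Finset.prod_eq_zero (Finset.mem_univ m) (if_neg hm)

theorem Pg_apply (i a r : Fin 2) :
    Pg i r a = if r = a + 1 then Complex.I ^ (i : ℕ) * (-1) ^ ((i : ℕ) * (a : ℕ)) else 0 := by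
  fin_cases i <;> fin_cases a <;> fin_cases r <;> simp [Pg, Xg, Yg]

theorem tens_Pg_mulVec_ket (i j k l a b c d e f : Fin 2) :
    (tens ![1, 1, Pg i, Pg j, Pg k, Pg l]).mulVec (ket ![a, b, c, d, e, f]) =
      (Complex.I ^ ((i : ℕ) + (j : ℕ) + (k : ℕ) + (l : ℕ)) *
        ((-1) ^ ((i : ℕ) * (c : ℕ) + (j : ℕ) * (d : ℕ)) *
          (-1) ^ ((k : ℕ) * (e : ℕ) + (l : ℕ) * (f : ℕ)))) •
        ket ![a, b, c + 1, d + 1, e + 1, f + 1] := by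
  rw [tens_mulVec_ket _ _ ![a, b, c + 1, d + 1, e + 1, f + 1]
    ![1, 1, Complex.I ^ (i : ℕ) * (-1) ^ ((i : ℕ) * (c : ℕ)),
      Complex.I ^ (j : ℕ) * (-1) ^ ((j : ℕ) * (d : ℕ)),
      Complex.I ^ (k : ℕ) * (-1) ^ ((k : ℕ) * (e : ℕ)),
      Complex.I ^ (l : ℕ) * (-1) ^ ((l : ℕ) * (f : ℕ))]]
  · congr 1
    simp only [Fin.prod_univ_six, Matrix.cons_val]
    ring
  · intro m r
    fin_cases m
    exacts [Matrix.one_apply, Matrix.one_apply, Pg_apply i c r, Pg_apply j d r, Pg_apply k e r,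
      Pg_apply l f r]

theorem neg_one_pow_mul_add_mul_flip (i a b : Fin 2) :
    (-1 : ℂ) ^ ((i : ℕ) * ((a + 1 : Fin 2) : ℕ) + (i : ℕ) * ((b + 1 : Fin 2) : ℕ)) =
      (-1) ^ ((i : ℕ) * (a : ℕ) + (i : ℕ) * (b : ℕ)) := by
  fin_cases i <;> fin_cases a <;> fin_cases b <;> simp

theorem Fin.eq_of_even_add_val {i j : Fin 2} (h : Even ((i : ℕ) + (j : ℕ))) : i = j := by
  revert h
  fin_cases i <;> fin_cases j <;> simp

theorem neg_one_pow_eq_mul_of_even_add {a b c : ℕ} (h : Even (a + b + c)) :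
    (-1 : ℂ) ^ c = (-1) ^ a * (-1) ^ b := by
  have h1 : (-1 : ℂ) ^ a * (-1) ^ b * (-1) ^ c = 1 := by
    rw [← pow_add, ← pow_add, h.neg_one_pow]
  have h2 : (-1 : ℂ) ^ c * (-1) ^ c = 1 := by
    rw [← pow_add, (Even.add_self c).neg_one_pow]
  linear_combination (-1 : ℂ) ^ a * (-1) ^ b * h2 - (-1) ^ c * h1

theorem stmt12 (q₁ q₂ q₅ q₆ A₁ x₁ x₂ x₃ : Fin 2)
    (hx : Even ((x₁ : ℕ) + (x₂ : ℕ) + (x₃ : ℕ)))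
    (s : ℂ) (hs : s = 1 ∨ s = -1)
    (i j k l : Fin 2) (hij : Even ((i : ℕ) + (j : ℕ))) (hkl : Even ((k : ℕ) + (l : ℕ))) :
    (tens ![1, 1, Pg i, Pg j, Pg k, Pg l]).mulVec (vA q₁ q₂ q₅ q₆ A₁ x₁ x₂ x₃ s) =
      (s * (-1 : ℂ) ^ (x₁ : ℕ) *
        Complex.I ^ ((i : ℕ) + (j : ℕ) + (k : ℕ) + (l : ℕ)) *
        (-1 : ℂ) ^ ((k : ℕ) * (q₅ : ℕ) + (l : ℕ) * (q₆ : ℕ) + (i : ℕ) * (A₁ : ℕ))) •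
        vA q₁ q₂ q₅ q₆ A₁ x₁ x₂ x₃ s := by
  obtain rfl := Fin.eq_of_even_add_val hij
  obtain rfl := Fin.eq_of_even_add_val hkl
  have flip_flip : ∀ a : Fin 2, a + 1 + 1 = a := by decide
  have hs2 : s * s = 1 := by rcases hs with rfl | rfl <;> norm_num
  have sq_eq_one : ∀ n : ℕ, (-1 : ℂ) ^ n * (-1) ^ n = 1 := fun n => by
    rw [← pow_add, (Even.add_self n).neg_one_pow]
  have hx₁ := sq_eq_one x₁
  have hA := neg_one_pow_mul_add_mul_flip i 0 A₁
  rw [zero_add] at hA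
  simp only [vA, Matrix.mulVec_add, Matrix.mulVec_smul, tens_Pg_mulVec_ket, hA,
    neg_one_pow_mul_add_mul_flip, flip_flip, neg_one_pow_eq_mul_of_even_add hx, zero_add,
    show (1 : Fin 2) + 1 = 0 from rfl, Fin.val_zero, mul_zero]
  rw [pow_add (-1 : ℂ) (_ + _) ((i : ℕ) * (A₁ : ℕ))]
  funext r
  simp only [Pi.add_apply, Pi.smul_apply, smul_eq_mul]
  generalize (-1 : ℂ) ^ (x₁ : ℕ) = u at *
  generalize (-1 : ℂ) ^ (x₂ : ℕ) = v at *
  generalize Complex.I ^ _ = w at *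
  generalize (-1 : ℂ) ^ ((i : ℕ) * (A₁ : ℕ)) = y at *
  generalize (-1 : ℂ) ^ ((k : ℕ) * (q₅ : ℕ) + (k : ℕ) * (q₆ : ℕ)) = z at *
  linear_combination
    -w * y * z *
      ((s * (ket ![q₁, q₂, 0, A₁, q₅ + 1, q₆ + 1] r
            + v * ket ![q₁ + 1, q₂ + 1, 0, A₁, q₅ + 1, q₆ + 1] r)
          + (ket ![q₁, q₂, 1, A₁ + 1, q₅ + 1, q₆ + 1] r
            + v * ket ![q₁ + 1, q₂ + 1, 1, A₁ + 1, q₅ + 1, q₆ + 1] r)) * hx₁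
        + (u * ket ![q₁, q₂, 1, A₁ + 1, q₅, q₆] r
          + u * v * ket ![q₁ + 1, q₂ + 1, 1, A₁ + 1, q₅, q₆] r
          + u ^ 2 * (ket ![q₁, q₂, 1, A₁ + 1, q₅ + 1, q₆ + 1] r
            + v * ket ![q₁ + 1, q₂ + 1, 1, A₁ + 1, q₅ + 1, q₆ + 1] r)) * hs2)
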